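/- In a weighted graph G whose vertex set carries a total order, for any two distinct vertices u and v in the same connected component, the lex shortest path between u and v exists and is unique. -/

import Mathlib

/-!
Common definitions for formalizing "Minimum Cycle Basis in Weighted Partial 2-trees".
-/

namespace LexMCB

open SimpleGraph

variable {V : Type*}

/-- The weight of a walk: the sum of the weights of its edges. -/
def walkWeight {G : SimpleGraph V} (w : Sym2 V → ℕ) {a b : V} (p : G.Walk a b) : ℕ :=
  (p.edges.map w).sum

/-- A walk is contained in the subgraph described by vertex set `V₁` and edge set `E₁`. -/
def WalkIn {G : SimpleGraph V} (V₁ : Set V) (E₁ : Set (Sym2 V)) {a b : V}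
    (p : G.Walk a b) : Prop :=
  (∀ t ∈ p.support, t ∈ V₁) ∧ ∀ e ∈ p.edges, e ∈ E₁

/-- `p` is lexicographically better than `q`: either it has smaller weight, or equal weight
and fewer edges, or equal weight and equally many edges and
`min (V(q) \ V(p)) > min (V(p) \ V(q))`. -/
def LexBetter [LinearOrder V] {G : SimpleGraph V} (w : Sym2 V → ℕ) {a b : V}
    (p q : G.Walk a b) : Prop :=
  walkWeight w p < walkWeight w q ∨
    (walkWeight w q = walkWeight w p ∧ p.length < q.length) ∨
    (walkWeight w q = walkWeight w p ∧ q.length = p.length ∧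
      (p.support.toFinset \ q.support.toFinset).min <
        (q.support.toFinset \ p.support.toFinset).min)

/-- `p` is the lex shortest path between its endpoints among the paths lying in the
subgraph described by vertex set `V₁` and edge set `E₁`. -/
def IsLexShortestPathIn [LinearOrder V] {G : SimpleGraph V} (w : Sym2 V → ℕ)
    (V₁ : Set V) (E₁ : Set (Sym2 V)) {a b : V} (p : G.Walk a b) : Prop :=
  p.IsPath ∧ WalkIn V₁ E₁ p ∧
    ∀ q : G.Walk a b, q.IsPath → WalkIn V₁ E₁ q → q ≠ p → LexBetter w p q

/-- `p` is the lex shortest path of `G` between its endpoints. -/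
def IsLexShortestPath [LinearOrder V] {G : SimpleGraph V} (w : Sym2 V → ℕ)
    {a b : V} (p : G.Walk a b) : Prop :=
  IsLexShortestPathIn w Set.univ G.edgeSet p

/-- A (sub)graph is a cycle: it is connected and every vertex has degree two. -/
def IsCycleSubgraph {G : SimpleGraph V} (C : G.Subgraph) : Prop :=
  C.Connected ∧ ∀ t ∈ C.verts, (C.neighborSet t).ncard = 2

/-- `C` is a lex short cycle of the subgraph of `G` described by vertex set `V₁` and
edge set `E₁`: it is a cycle lying there, and for any two distinct vertices `x,y` of `C`
the lex shortest `x`-`y` path of that subgraph is contained in `C`. -/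
def IsLexShortCycleIn [LinearOrder V] {G : SimpleGraph V} (w : Sym2 V → ℕ)
    (V₁ : Set V) (E₁ : Set (Sym2 V)) (C : G.Subgraph) : Prop :=
  C.verts ⊆ V₁ ∧ C.edgeSet ⊆ E₁ ∧ IsCycleSubgraph C ∧
    ∀ x ∈ C.verts, ∀ y ∈ C.verts, x ≠ y →
      ∀ p : G.Walk x y, IsLexShortestPathIn w V₁ E₁ p → ∀ e ∈ p.edges, e ∈ C.edgeSet

/-- The set of lex short cycles of the subgraph of `G` described by `V₁`, `E₁`. -/
def LSCIn [LinearOrder V] (G : SimpleGraph V) (w : Sym2 V → ℕ)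
    (V₁ : Set V) (E₁ : Set (Sym2 V)) : Set G.Subgraph :=
  {C | IsLexShortCycleIn w V₁ E₁ C}

/-- The set of lex short cycles of `G`. -/
def LSC [LinearOrder V] (G : SimpleGraph V) (w : Sym2 V → ℕ) : Set G.Subgraph :=
  LSCIn G w Set.univ G.edgeSet

/-! ### Components and separators -/

/-- The edges of `G` lying within the vertex set `H`. -/
def edgesWithin (G : SimpleGraph V) (H : Set V) : Set (Sym2 V) :=
  {e | e ∈ G.edgeSet ∧ ∀ t ∈ e, t ∈ H}

/-- `H` is (the vertex set of) a connected component of the induced subgraph `G[A]`: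
it is a maximal subset of `A` inducing a connected subgraph. -/
def IsComponentOf (G : SimpleGraph V) (A : Set V) (H : Set V) : Prop :=
  H.Nonempty ∧ H ⊆ A ∧ (G.induce H).Connected ∧
    ∀ K : Set V, H ⊆ K → K ⊆ A → (G.induce K).Connected → K = H

/-- `{u, v}` is a vertex separator of `G` : deleting `u` and `v` disconnects `G`. -/
def IsSeparatorPair (G : SimpleGraph V) (u v : V) : Prop :=
  ¬ (G.induce {t | t ≠ u ∧ t ≠ v}).Connected

/-- The number of connected components of `G - {u, v}`. -/
noncomputable def numComponentsDel (G : SimpleGraph V) (u v : V) : ℕ :=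
  Nat.card ((G.induce {t | t ≠ u ∧ t ≠ v}).ConnectedComponent)

/-! ### Subdivisions of `K₄` and `K_{2,3}`, outerplanarity -/

/-- The interior (internal vertices) of a walk. -/
def walkInterior {G : SimpleGraph V} {a b : V} (p : G.Walk a b) : Set V :=
  {t | t ∈ p.support} \ {a, b}

/-- A `K_{2,3}`-subdivision in `G` with branch vertices `u, v` (the side of size two)
and `x, y, z` (the side of size three): six internally disjoint paths joining each of
`u, v` to each of `x, y, z`, whose interiors avoid the branch vertices. -/
structure K23Subdiv (G : SimpleGraph V) (u v x y z : V) where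
  pux : G.Walk u x
  puy : G.Walk u y
  puz : G.Walk u z
  pvx : G.Walk v x
  pvy : G.Walk v y
  pvz : G.Walk v z
  branch_nodup : List.Pairwise (· ≠ ·) [u, v, x, y, z]
  isPath_pux : pux.IsPath
  isPath_puy : puy.IsPath
  isPath_puz : puz.IsPath
  isPath_pvx : pvx.IsPath
  isPath_pvy : pvy.IsPath
  isPath_pvz : pvz.IsPath
  interiors_disjoint : List.Pairwise Disjoint
    [walkInterior pux, walkInterior puy, walkInterior puz,
     walkInterior pvx, walkInterior pvy, walkInterior pvz]
  interiors_avoid_branch : ∀ s ∈ [walkInterior pux, walkInterior puy, walkInterior puz,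
      walkInterior pvx, walkInterior pvy, walkInterior pvz],
    ∀ t ∈ s, t ∉ ({u, v, x, y, z} : Set V)

/-- The vertex set of a `K_{2,3}`-subdivision. -/
def K23Subdiv.vertSet {G : SimpleGraph V} {u v x y z : V} (K : K23Subdiv G u v x y z) :
    Set V :=
  {t | t ∈ K.pux.support ∨ t ∈ K.puy.support ∨ t ∈ K.puz.support ∨
       t ∈ K.pvx.support ∨ t ∈ K.pvy.support ∨ t ∈ K.pvz.support}

/-- The edge set of a `K_{2,3}`-subdivision. -/
def K23Subdiv.edges {G : SimpleGraph V} {u v x y z : V} (K : K23Subdiv G u v x y z) :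
    Set (Sym2 V) :=
  {e | e ∈ K.pux.edges ∨ e ∈ K.puy.edges ∨ e ∈ K.puz.edges ∨
       e ∈ K.pvx.edges ∨ e ∈ K.pvy.edges ∨ e ∈ K.pvz.edges}

/-- `G` contains a subdivision of `K_{2,3}`. -/
def HasK23Subdivision (G : SimpleGraph V) : Prop :=
  ∃ u v x y z : V, Nonempty (K23Subdiv G u v x y z)

/-- The subgraph `S` of `G` is (exactly) a `K_{2,3}`-subdivision. -/
def IsK23SubdivisionSubgraph {G : SimpleGraph V} (S : G.Subgraph) : Prop :=
  ∃ (u v x y z : V) (K : K23Subdiv G u v x y z),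
    K.vertSet = S.verts ∧ K.edges = S.edgeSet

/-- A `K₄`-subdivision in `G` with branch vertices `a, b, c, d`. -/
structure K4Subdiv (G : SimpleGraph V) (a b c d : V) where
  pab : G.Walk a b
  pac : G.Walk a c
  pad : G.Walk a d
  pbc : G.Walk b c
  pbd : G.Walk b d
  pcd : G.Walk c d
  branch_nodup : List.Pairwise (· ≠ ·) [a, b, c, d]
  isPath_pab : pab.IsPath
  isPath_pac : pac.IsPath
  isPath_pad : pad.IsPath
  isPath_pbc : pbc.IsPath
  isPath_pbd : pbd.IsPath
  isPath_pcd : pcd.IsPath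
  interiors_disjoint : List.Pairwise Disjoint
    [walkInterior pab, walkInterior pac, walkInterior pad,
     walkInterior pbc, walkInterior pbd, walkInterior pcd]
  interiors_avoid_branch : ∀ s ∈ [walkInterior pab, walkInterior pac, walkInterior pad,
      walkInterior pbc, walkInterior pbd, walkInterior pcd],
    ∀ t ∈ s, t ∉ ({a, b, c, d} : Set V)

/-- `G` contains a subdivision of `K₄`. -/
def HasK4Subdivision (G : SimpleGraph V) : Prop :=
  ∃ a b c d : V, Nonempty (K4Subdiv G a b c d)

/-- `G` is outerplanar.  (We use the classical combinatorial characterization: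
a graph is outerplanar iff it has no subgraph that is a subdivision of `K₄` or of
`K_{2,3}`.) -/
def IsOuterplanar (G : SimpleGraph V) : Prop :=
  ¬ HasK4Subdivision G ∧ ¬ HasK23Subdivision G

/-! ### 2-trees and partial 2-trees -/

/-- Add to `G` a new vertex adjacent to (exactly) `a` and `b`. -/
def addVertexOnEdge {n : ℕ} (G : SimpleGraph (Fin n)) (a b : Fin n) :
    SimpleGraph (Fin (n + 1)) :=
  SimpleGraph.fromRel fun i j =>
    (∃ i' j' : Fin n, i = Fin.castSucc i' ∧ j = Fin.castSucc j' ∧ G.Adj i' j') ∨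
    (i = Fin.last n ∧ (j = Fin.castSucc a ∨ j = Fin.castSucc b))

/-- 2-trees, defined inductively: `K₃` is a 2-tree, and adding a new vertex whose
neighbourhood is an edge of a 2-tree again gives a 2-tree. -/
inductive IsTwoTree : ∀ {n : ℕ}, SimpleGraph (Fin n) → Prop
  | base : IsTwoTree (⊤ : SimpleGraph (Fin 3))
  | extend {n : ℕ} (G : SimpleGraph (Fin n)) (a b : Fin n) :
      IsTwoTree G → G.Adj a b → IsTwoTree (addVertexOnEdge G a b)

/-- A partial 2-tree: a subgraph of a 2-tree. -/
def IsPartialTwoTree {W : Type*} (G : SimpleGraph W) : Prop :=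
  ∃ (n : ℕ) (T : SimpleGraph (Fin n)) (f : W ↪ Fin n),
    IsTwoTree T ∧ ∀ x y : W, G.Adj x y → T.Adj (f x) (f y)

/-! ### The cycle space over `𝔽₂`, cycle bases and minimum cycle bases -/

/-- The incidence vector (over `𝔽₂`) of a subgraph, indexed by `Sym2 V`. -/
noncomputable def cycleIncVec {G : SimpleGraph V} (C : G.Subgraph) : Sym2 V → ZMod 2 :=
  C.edgeSet.indicator fun _ => 1

/-- The cycle space of `G`: the span over `𝔽₂` of the incidence vectors of cycles. -/
def cycleSpace (G : SimpleGraph V) : Submodule (ZMod 2) (Sym2 V → ZMod 2) :=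
  Submodule.span (ZMod 2) (cycleIncVec '' {C : G.Subgraph | IsCycleSubgraph C})

/-- `B` is a cycle basis of `G`: a minimum-cardinality set of cycles whose incidence
vectors span the cycle space of `G`. -/
def IsCycleBasis (G : SimpleGraph V) (B : Set G.Subgraph) : Prop :=
  (∀ C ∈ B, IsCycleSubgraph C) ∧
    Submodule.span (ZMod 2) (cycleIncVec '' B) = cycleSpace G ∧
    ∀ B' : Set G.Subgraph, (∀ C ∈ B', IsCycleSubgraph C) →
      Submodule.span (ZMod 2) (cycleIncVec '' B') = cycleSpace G → B.ncard ≤ B'.ncard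

/-- The weight of a cycle: the sum of the weights of its edges. -/
noncomputable def cycleWeight {G : SimpleGraph V} (w : Sym2 V → ℕ) (C : G.Subgraph) : ℕ :=
  ∑ᶠ e ∈ C.edgeSet, w e

/-- The total weight of a set of cycles. -/
noncomputable def basisWeight {G : SimpleGraph V} (w : Sym2 V → ℕ)
    (B : Set G.Subgraph) : ℕ :=
  ∑ᶠ C ∈ B, cycleWeight w C

/-- `B` is a minimum cycle basis of `G`: a cycle basis of minimum total weight. -/
def IsMinimumCycleBasis (G : SimpleGraph V) (w : Sym2 V → ℕ) (B : Set G.Subgraph) : Prop :=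
  IsCycleBasis G B ∧ ∀ B' : Set G.Subgraph, IsCycleBasis G B' →
    basisWeight w B ≤ basisWeight w B'

/-! ### The `decomp` operation -/

/-- The vertex set of the first part `G₁` of `decomp(G,u,v)`. -/
def decompVerts1 {G : SimpleGraph V} {u v : V} (P : G.Walk u v) (H : Set V) : Set V :=
  H ∪ {t | t ∈ P.support}

/-- The edge set of the first part `G₁` of `decomp(G,u,v)`:
`E(H) ∪ E(lsp(u,v)) ∪ {(x,y) : x ∈ V(H), y ∈ {u,v}, (x,y) ∈ E(G)}`. -/
def decompEdges1 {G : SimpleGraph V} {u v : V} (P : G.Walk u v) (H : Set V) :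
    Set (Sym2 V) :=
  edgesWithin G H ∪ {e | e ∈ P.edges} ∪
    {e | ∃ a ∈ H, ∃ c ∈ ({u, v} : Set V), G.Adj a c ∧ e = s(a, c)}


/-- `p` has minimum weight among the walks between its endpoints, and minimum length among
those of minimum weight. -/
def IsMinCost {G : SimpleGraph V} (w : Sym2 V → ℕ) {a b : V} (p : G.Walk a b) : Prop :=
  ∀ r : G.Walk a b, walkWeight w p < walkWeight w r ∨
    (walkWeight w p = walkWeight w r ∧ p.length ≤ r.length)

@[simp]
lemma walkWeight_cons {G : SimpleGraph V} (w : Sym2 V → ℕ) {a b c : V} (h : G.Adj a b)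
    (p : G.Walk b c) : walkWeight w (Walk.cons h p) = w s(a, b) + walkWeight w p := by
  simp [walkWeight]

lemma walkWeight_append {G : SimpleGraph V} (w : Sym2 V → ℕ) {a b c : V} (p : G.Walk a b)
    (q : G.Walk b c) : walkWeight w (p.append q) = walkWeight w p + walkWeight w q := by
  simp [walkWeight]

lemma walkWeight_bypass_le {G : SimpleGraph V} [DecidableEq V] (w : Sym2 V → ℕ) {a b : V}
    (p : G.Walk a b) : walkWeight w p.bypass ≤ walkWeight w p :=
  (p.edges_bypass_sublist_edges.map w).sum_le_sum fun _ _ => Nat.zero_le _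

lemma IsMinCost.tail {G : SimpleGraph V} {w : Sym2 V → ℕ} {a b c : V} {h : G.Adj a b}
    {p : G.Walk b c} (hp : IsMinCost w (Walk.cons h p)) : IsMinCost w p := by
  intro r
  have := hp (Walk.cons h r)
  simp only [walkWeight_cons, Walk.length_cons] at this
  omega

/-- The first edge of a minimum-cost walk is lighter than the direct edge to any neighbour of
the start that the walk visits after its second vertex. -/
lemma IsMinCost.first_edge_lt {G : SimpleGraph V} [DecidableEq V] {w : Sym2 V → ℕ}
    {u a b v : V} {h : G.Adj u b} {q : G.Walk b v} (hq : IsMinCost w (Walk.cons h q))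
    (ha : G.Adj u a) (hmem : a ∈ q.support) (hab : a ≠ b) : w s(u, b) < w s(u, a) := by
  have hmin := hq (Walk.cons ha (q.dropUntil a hmem))
  have hweight := walkWeight_append w (q.takeUntil a hmem) (q.dropUntil a hmem)
  have hlength := Walk.length_append (q.takeUntil a hmem) (q.dropUntil a hmem)
  rw [Walk.take_spec] at hweight hlength
  have hpos : 0 < (q.takeUntil a hmem).length :=
    Nat.pos_of_ne_zero fun h0 => hab (Walk.eq_of_length_eq_zero h0).symm
  simp only [walkWeight_cons, Walk.length_cons] at hmin
  omega

/-- Two minimum-cost paths with the same endpoints and the same vertex set are equal. -/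
lemma IsMinCost.eq_of_support {G : SimpleGraph V} {w : Sym2 V → ℕ} {u v : V}
    {p q : G.Walk u v} (hp : IsMinCost w p) (hq : IsMinCost w q) (hp' : p.IsPath)
    (hq' : q.IsPath) (hs : ∀ x, x ∈ p.support ↔ x ∈ q.support) : p = q := by
  classical
  induction p with
  | nil => exact (Walk.isPath_iff_nil.mp hq').eq_nil.symm
  | @cons u a v h p ih =>
    cases q with
    | nil => exact (Walk.isPath_iff_nil.mp hp').eq_nil
    | @cons _ b _ h' q =>
      rw [Walk.cons_isPath_iff] at hp' hq'
      have hs' : ∀ x, x ∈ p.support ↔ x ∈ q.support := by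
        intro x
        have hx := hs x
        simp only [Walk.support_cons, List.mem_cons] at hx
        by_cases hxu : x = u
        · subst hxu
          exact iff_of_false hp'.2 hq'.2
        · simpa [hxu] using hx
      obtain rfl : a = b := by
        by_contra hab
        have hlt := hq.first_edge_lt h ((hs' a).mp p.start_mem_support) hab
        have hgt := hp.first_edge_lt h' ((hs' b).mpr q.start_mem_support) (Ne.symm hab)
        exact lt_asymm hlt hgt
      rw [ih hp.tail hq.tail hp'.1 hq'.1 hs']

/-- The lexicographic key (weight, length, vertex set) by which walks are compared; vertex sets
are recorded by the indicator of their complement. -/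
def lexKey [LinearOrder V] {G : SimpleGraph V} (w : Sym2 V → ℕ) {a b : V} (p : G.Walk a b) :
    ℕ ×ₗ ℕ ×ₗ Lex (V → Bool) :=
  toLex (walkWeight w p, toLex (p.length, toLex fun x => decide (x ∉ p.support)))

lemma lexBetter_of_lexKey_lt [LinearOrder V] {G : SimpleGraph V} {w : Sym2 V → ℕ} {a b : V}
    {p q : G.Walk a b} (h : lexKey w p < lexKey w q) : LexBetter w p q := by
  simp only [lexKey, Prod.Lex.toLex_lt_toLex] at h
  obtain h | ⟨hw, h | ⟨hl, i, heq, hlt⟩⟩ := h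
  · exact Or.inl h
  · exact Or.inr (Or.inl ⟨hw.symm, h⟩)
  · refine Or.inr (Or.inr ⟨hw.symm, hl.symm, ?_⟩)
    simp only [Pi.toLex_apply, decide_eq_decide, not_iff_not] at heq
    simp only [Pi.toLex_apply, Bool.lt_iff, decide_eq_false_iff_not, not_not,
      decide_eq_true_eq] at hlt
    have hmem : i ∈ p.support.toFinset \ q.support.toFinset := by simpa using hlt
    refine (Finset.min_le hmem).trans_lt ?_
    rw [Finset.min, Finset.lt_inf_iff (WithTop.coe_lt_top i)]
    intro x hx
    simp only [Finset.mem_sdiff, List.mem_toFinset] at hx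
    refine WithTop.coe_lt_coe.mpr (lt_of_not_ge fun hxi => ?_)
    obtain rfl | hxi := eq_or_lt_of_le hxi
    · exact hx.2 hlt.1
    · exact hx.2 ((heq x hxi).mpr hx.1)

lemma LexBetter.asymm [LinearOrder V] {G : SimpleGraph V} {w : Sym2 V → ℕ} {a b : V}
    {p q : G.Walk a b} (h : LexBetter w p q) : ¬ LexBetter w q p := by
  intro h'
  obtain h | ⟨h, hl⟩ | ⟨h, hl, hm⟩ := h <;> obtain h' | ⟨h', hl'⟩ | ⟨h', hl', hm'⟩ := h' <;>
    first | omega | exact lt_asymm hm hm'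

lemma walkIn_univ_edgeSet {G : SimpleGraph V} {a b : V} (p : G.Walk a b) :
    WalkIn Set.univ G.edgeSet p :=
  ⟨fun _ _ => Set.mem_univ _, fun _ he => p.edges_subset_edgeSet he⟩

lemma isMinCost_of_lexKey_le [LinearOrder V] [WellFoundedLT V] {G : SimpleGraph V}
    {w : Sym2 V → ℕ} {a b : V} {p : G.Walk a b}
    (h : ∀ q : G.Walk a b, q.IsPath → lexKey w p ≤ lexKey w q) : IsMinCost w p := by
  intro r
  have hle := h r.bypass r.bypass_isPath
  have hweight := walkWeight_bypass_le w r
  have hlength := r.length_bypass_le_length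
  simp only [lexKey, Prod.Lex.toLex_le_toLex] at hle
  omega

variable [Fintype V] [LinearOrder V]

theorem existsUnique_isLexShortestPath
    (G : SimpleGraph V) (w : Sym2 V → ℕ)
    (u v : V) (huv : u ≠ v) (hreach : G.Reachable u v) :
    ∃! p : G.Walk u v, IsLexShortestPath w p := by
  let S : Set (G.Walk u v) := {p | p.IsPath}
  obtain ⟨r⟩ := hreach
  have hS : S.Nonempty := ⟨r.bypass, r.bypass_isPath⟩
  have hwf : WellFounded fun p q : G.Walk u v => lexKey w p < lexKey w q :=
    InvImage.wf (lexKey w) wellFounded_lt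
  obtain ⟨p, hp, hmin⟩ := hwf.has_min S hS
  have hmin : ∀ q : G.Walk u v, q.IsPath → lexKey w p ≤ lexKey w q :=
    fun q hq => not_lt.mp (hmin q hq)
  have hlex : IsLexShortestPath w p := by
    refine ⟨hp, walkIn_univ_edgeSet p, fun q hq _ hne => ?_⟩
    refine lexBetter_of_lexKey_lt ((hmin q hq).lt_of_ne fun heq => hne ?_)
    have hminq : IsMinCost w q := isMinCost_of_lexKey_le (heq ▸ hmin)
    refine hminq.eq_of_support (isMinCost_of_lexKey_le hmin) hq hp fun x => ?_
    simp only [lexKey, EmbeddingLike.apply_eq_iff_eq, Prod.mk.injEq] at heq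
    have hx := congrFun heq.2.2 x
    simpa [not_iff_not, iff_comm] using hx
  refine ⟨p, hlex, fun q hq => ?_⟩
  by_contra hne
  exact (hlex.2.2 q hq.1 hq.2.1 hne).asymm (hq.2.2 p hp (walkIn_univ_edgeSet p) (Ne.symm hne))

end LexMCB
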